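/- Let a ∈ ℕ with a ≥ 1, and let β > 1 be the positive root of X² − aX − 1 (so β² = aβ + 1). Then every alphabet A of contiguous integers containing 0 of cardinality a+2 allows parallel addition on Fin_A(β); moreover, the cardinality a+2 is minimal: no alphabet of contiguous integers containing 0 and 1 of cardinality less than a+2 allows parallel addition on Fin_A(β). -/

import Mathlib

open scoped Pointwise

/-- The value `∑_{j ∈ ℤ} u_j β^j` of a (finitely supported) bi-infinite digit string. -/
noncomputable def seqValue (β : ℝ) (u : ℤ → ℝ) : ℝ := ∑ᶠ j : ℤ, u j * β ^ j

/-- `φ` is a `p`-local function realized by `Φ` (with memory `r` and anticipation `t`,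
`p = r + t + 1`, and `(φ u) j = Φ (u_{j+t}, …, u_{j-r})`). -/
def IsLocallyRealized (p : ℕ) (φ : (ℤ → ℝ) → ℤ → ℝ) (Φ : (Fin p → ℝ) → ℝ) : Prop :=
  ∃ r t : ℕ, p = r + t + 1 ∧
    ∀ (u : ℤ → ℝ) (j : ℤ), φ u j = Φ (fun i => u (j + (t : ℤ) - ((i : ℕ) : ℤ)))

/-- `φ` is a digit set conversion in base `β` from alphabet `A` to alphabet `B`:
it maps `A`-valued strings to `B`-valued strings, preserves finiteness of support,
and preserves the represented value. -/
def IsDigitSetConversion (β : ℝ) (A B : Set ℝ) (φ : (ℤ → ℝ) → ℤ → ℝ) : Prop :=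
  (∀ u : ℤ → ℝ, (∀ j, u j ∈ A) → ∀ j, φ u j ∈ B) ∧
  ∀ u : ℤ → ℝ, (∀ j, u j ∈ A) → (Function.support u).Finite →
    (Function.support (φ u)).Finite ∧ seqValue β (φ u) = seqValue β u

/-- There is a digit set conversion in base `β` from `A` to `B` computable in parallel. -/
def ParallelConversion (β : ℝ) (A B : Set ℝ) : Prop :=
  ∃ (p : ℕ) (φ : (ℤ → ℝ) → ℤ → ℝ) (Φ : (Fin p → ℝ) → ℝ),
    IsLocallyRealized p φ Φ ∧ IsDigitSetConversion β A B φ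

/-- Addition on `Fin_A(β)` can be performed in parallel: there is a parallel digit set
conversion from `A + A` to `A`. -/
def ParallelAddition (β : ℝ) (A : Set ℝ) : Prop :=
  ParallelConversion β (A + A) A

/-- The alphabet of contiguous integers `{m, …, M}`, viewed inside `ℝ`. -/
def intAlphabet (m M : ℤ) : Set ℝ := (fun k : ℤ => (k : ℝ)) '' Set.Icc m M

/-- The digits `y`, with right neighbour `yr` and left neighbours `yl`, `yll`, at which a carry `1`
is sent to the left; digits are normalized to `0, …, a + 2`. -/
def CarriesUp (a yr y yl yll : ℤ) : Prop :=
  y = a + 2 ∨ (y = a ∧ yl = 0 ∧ a + 1 ≤ yr) ∨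
    (y = a + 1 ∧ yl ≠ a + 2 ∧
      ¬ (yr = 0 ∧ ((yl = a + 1 ∧ yll ≠ a + 2) ∨ (yl = a ∧ yll = 0))))

instance (a yr y yl yll : ℤ) : Decidable (CarriesUp a yr y yl yll) := by
  unfold CarriesUp; infer_instance

/-- The carry in greatest digit elimination from `{0, …, a + 2}` to `{0, …, a + 1}`. -/
def carry (a yrr yr y yl yll ylll : ℤ) : ℤ :=
  if CarriesUp a yr y yl yll then 1
  else if y = 0 ∧ CarriesUp a y yl yll ylll ∧ ¬ CarriesUp a yrr yr y yl then -1 else 0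

lemma carry_bounds {a : ℤ} (ha : 1 ≤ a) (x₃ x₂ x₁ y y₁ y₂ y₃ y₄ : ℤ)
    (h0 : 0 ≤ y) (h1 : y ≤ a + 2)
    (hr1 : x₁ ≤ a + 2) (hl1 : y₁ ≤ a + 2)
    (hsep : a = 1 → ¬ (x₁ = 3 ∧ y = 3)) :
    y + carry a x₃ x₂ x₁ y y₁ y₂ - a * carry a x₂ x₁ y y₁ y₂ y₃ -
      carry a x₁ y y₁ y₂ y₃ y₄ ∈ Set.Icc 0 (a + 1) := by
  rw [Set.mem_Icc]
  generalize hz : y + carry a x₃ x₂ x₁ y y₁ y₂ - a * carry a x₂ x₁ y y₁ y₂ y₃ -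
      carry a x₁ y y₁ y₂ y₃ y₄ = z
  unfold carry at hz
  split_ifs at hz <;> simp only [CarriesUp] at * <;> grind

/-- The value in base `β` of a bi-infinite string of integers. -/
noncomputable def intValue (β : ℝ) (u : ℤ → ℤ) : ℝ := seqValue β (fun j => (u j : ℝ))

/-- A map on integer strings is local if each output digit is determined, uniformly in the
position, by a window of bounded size around it. -/
def LocalAt (N : ℕ) (φ : (ℤ → ℤ) → ℤ → ℤ) : Prop :=
  ∀ (u v : ℤ → ℤ) (j k : ℤ), (∀ i : ℤ, -N ≤ i → i ≤ N → u (j + i) = v (k + i)) → φ u j = φ v k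

/-- `φ` is a local map from `S` to `T` preserving finiteness of supports and values. -/
structure Converts (β : ℝ) (S T : Set (ℤ → ℤ)) (φ : (ℤ → ℤ) → ℤ → ℤ) : Prop where
  isLocal : ∃ N, LocalAt N φ
  mapsTo : ∀ u ∈ S, φ u ∈ T
  finite : ∀ u ∈ S, u.support.Finite → (φ u).support.Finite
  value : ∀ u ∈ S, u.support.Finite → intValue β (φ u) = intValue β u

/-- Integer strings with all digits between `m` and `M`. -/
def digits (m M : ℤ) : Set (ℤ → ℤ) := {u | ∀ j, m ≤ u j ∧ u j ≤ M}

lemma support_cast_mul_zpow_finite (β : ℝ) {u : ℤ → ℤ} (hu : u.support.Finite) :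
    (Function.support fun j => (u j : ℝ) * β ^ j).Finite := by
  refine hu.subset fun j hj => ?_
  contrapose! hj
  simp_all

lemma intValue_add (β : ℝ) {u v : ℤ → ℤ} (hu : u.support.Finite) (hv : v.support.Finite) :
    intValue β (fun j => u j + v j) = intValue β u + intValue β v := by
  unfold intValue seqValue
  rw [← finsum_add_distrib (support_cast_mul_zpow_finite β hu)
    (support_cast_mul_zpow_finite β hv)]
  congr 1
  ext j
  push_cast
  ring

lemma intValue_const_mul (β : ℝ) (c : ℤ) (u : ℤ → ℤ) :
    intValue β (fun j => c * u j) = c * intValue β u := by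
  unfold intValue seqValue
  dsimp only
  rw [mul_finsum]
  congr 1
  ext j
  push_cast
  ring

lemma intValue_shift {β : ℝ} (hβ : β ≠ 0) (c : ℤ) (u : ℤ → ℤ) :
    intValue β (fun j => u (j + c)) = β ^ (-c) * intValue β u := by
  unfold intValue seqValue
  dsimp only
  rw [mul_finsum]
  rw [← finsum_comp_equiv (Equiv.addRight c) (f := fun j => β ^ (-c) * ((u j : ℝ) * β ^ j))]
  congr 1
  ext j
  simp only [Equiv.coe_addRight]
  rw [mul_left_comm, ← zpow_add₀ hβ]
  congr 2
  ring

lemma support_shift_finite (c : ℤ) {u : ℤ → ℤ} (hu : u.support.Finite) :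
    (Function.support fun j => u (j + c)).Finite :=
  hu.preimage (f := fun j : ℤ => j + c) (fun _ _ _ _ h => by simpa using h)

lemma LocalAt.comp {N N' : ℕ} {φ ψ : (ℤ → ℤ) → ℤ → ℤ} (hφ : LocalAt N φ) (hψ : LocalAt N' ψ) :
    LocalAt (N + N') (fun u => ψ (φ u)) := by
  intro u v j k huv
  refine hψ _ _ _ _ fun i h1 h2 => hφ _ _ _ _ fun i' h3 h4 => ?_
  have := huv (i + i') (by push_cast; omega) (by push_cast; omega)
  rwa [← add_assoc, ← add_assoc] at this

lemma LocalAt.support_finite {N : ℕ} {φ : (ℤ → ℤ) → ℤ → ℤ} (hφ : LocalAt N φ)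
    (h0 : φ 0 0 = 0) {u : ℤ → ℤ} (hu : u.support.Finite) : (φ u).support.Finite := by
  refine ((hu.prod (Set.finite_Icc (-(N : ℤ)) N)).image (fun p => p.1 - p.2)).subset fun j hj => ?_
  by_contra hcon
  refine hj ?_
  rw [← h0]
  refine hφ _ _ _ _ fun i h1 h2 => ?_
  by_contra hne
  exact hcon ⟨(j + i, i), ⟨by simpa using hne, h1, h2⟩, by simp⟩

lemma Converts.comp {β : ℝ} {S T R : Set (ℤ → ℤ)} {φ ψ : (ℤ → ℤ) → ℤ → ℤ}
    (hφ : Converts β S T φ) (hψ : Converts β T R ψ) : Converts β S R (fun u => ψ (φ u)) := by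
  obtain ⟨N, hN⟩ := hφ.isLocal
  obtain ⟨N', hN'⟩ := hψ.isLocal
  refine ⟨⟨_, hN.comp hN'⟩, fun u hu => hψ.mapsTo _ (hφ.mapsTo u hu),
    fun u hu h => hψ.finite _ (hφ.mapsTo u hu) (hφ.finite u hu h), fun u hu h => ?_⟩
  rw [hψ.value _ (hφ.mapsTo u hu) (hφ.finite u hu h), hφ.value u hu h]

/-- Convert only the part `f` of each digit, keeping the rest. -/
lemma Converts.split {β : ℝ} {S S' T R : Set (ℤ → ℤ)} {φ : (ℤ → ℤ) → ℤ → ℤ}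
    (hφ : Converts β S' T φ) (f : ℤ → ℤ) (hf : f 0 = 0) (hS : ∀ u ∈ S, (fun j => f (u j)) ∈ S')
    (hR : ∀ u ∈ S, ∀ t ∈ T, (fun j => t j + (u j - f (u j))) ∈ R) :
    Converts β S R (fun u j => φ (fun j => f (u j)) j + (u j - f (u j))) := by
  obtain ⟨N, hN⟩ := hφ.isLocal
  have hfin : ∀ u : ℤ → ℤ, u.support.Finite → (Function.support fun j => f (u j)).Finite := by
    refine fun u h => h.subset fun j hj => ?_
    contrapose! hj
    simp_all
  have hfin' : ∀ u : ℤ → ℤ, u.support.Finite →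
      (Function.support fun j => u j - f (u j)).Finite := by
    refine fun u h => h.subset fun j hj => ?_
    contrapose! hj
    simp_all
  refine ⟨⟨N, fun u v j k huv => ?_⟩, fun u hu => hR u hu _ (hφ.mapsTo _ (hS u hu)),
    fun u hu h => ?_, fun u hu h => ?_⟩
  · have h0 := huv 0 (by omega) (by omega)
    simp only [add_zero] at h0
    dsimp only
    rw [h0]
    congr 1
    exact hN _ _ _ _ fun i h1 h2 => by rw [huv i h1 h2]
  · refine ((hφ.finite _ (hS u hu) (hfin u h)).union (hfin' u h)).subset fun j hj => ?_
    contrapose! hj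
    simp_all
  · rw [intValue_add β (hφ.finite _ (hS u hu) (hfin u h)) (hfin' u h),
      hφ.value _ (hS u hu) (hfin u h), ← intValue_add β (hfin u h) (hfin' u h)]
    simp

lemma intValue_neg (β : ℝ) (u : ℤ → ℤ) : intValue β (-u) = -intValue β u := by
  have h := intValue_const_mul β (-1) u
  rw [Int.cast_neg, Int.cast_one, neg_one_mul] at h
  rw [← h]
  congr 1
  ext j
  simp

lemma neg_mem_digits {m M : ℤ} {u : ℤ → ℤ} : -u ∈ digits (-M) (-m) ↔ u ∈ digits m M := by
  simp only [digits, Set.mem_ofPred_eq, Pi.neg_apply, neg_le_neg_iff]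
  exact forall_congr' fun _ => and_comm

lemma Converts.neg {β : ℝ} {m M m' M' : ℤ} {φ : (ℤ → ℤ) → ℤ → ℤ}
    (hφ : Converts β (digits m M) (digits m' M') φ) :
    Converts β (digits (-M) (-m)) (digits (-M') (-m')) (fun u => -φ (-u)) := by
  obtain ⟨N, hN⟩ := hφ.isLocal
  have hmem : ∀ u ∈ digits (-M) (-m), -u ∈ digits m M := fun u hu => by
    simpa using neg_mem_digits.2 hu
  refine ⟨⟨N, fun u v j k huv => ?_⟩, fun u hu => neg_mem_digits.2 (hφ.mapsTo _ (hmem u hu)),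
    fun u hu h => ?_, fun u hu h => ?_⟩
  · simp only [Pi.neg_apply, neg_inj]
    exact hN _ _ _ _ fun i h1 h2 => by simp [huv i h1 h2]
  · rw [Function.support_neg]
    exact hφ.finite _ (hmem u hu) (by rwa [Function.support_neg])
  · have h' : (-u).support.Finite := by rwa [Function.support_neg]
    rw [intValue_neg, hφ.value _ (hmem u hu) h', intValue_neg, neg_neg]

/-- Adding a local multiple of the relation `β² = aβ + 1` preserves values. -/
lemma converts_of_carry {a : ℤ} {β : ℝ} (hβ : 1 < β) (hroot : β ^ 2 = (a : ℝ) * β + 1)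
    {S T : Set (ℤ → ℤ)} {q : (ℤ → ℤ) → ℤ → ℤ} {N : ℕ} (hq : LocalAt N q) (hq0 : q 0 0 = 0)
    (hT : ∀ u ∈ S, (fun j => u j + (q u (j - 1) + (-a * q u j + -1 * q u (j + 1)))) ∈ T) :
    Converts β S T (fun u j => u j + (q u (j - 1) + (-a * q u j + -1 * q u (j + 1)))) := by
  have hβ0 : β ≠ 0 := by positivity
  have hloc : LocalAt (N + 1)
      (fun u j => u j + (q u (j - 1) + (-a * q u j + -1 * q u (j + 1)))) := by
    intro u v j k huv
    have h0 := huv 0 (by omega) (by omega)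
    have hs : ∀ c : ℤ, -1 ≤ c → c ≤ 1 → q u (j + c) = q v (k + c) := fun c hc hc' =>
      hq _ _ _ _ fun i h1 h2 => by
        have := huv (c + i) (by push_cast; omega) (by push_cast; omega)
        rwa [← add_assoc, ← add_assoc] at this
    have h1 := hs (-1) (by omega) (by omega)
    have h2 := hs 0 (by omega) (by omega)
    have h3 := hs 1 (by omega) (by omega)
    simp only [add_zero] at h0 h2
    simp only [sub_eq_add_neg, h0, h1, h2, h3]
  have hz : ∀ c : ℤ, q 0 c = 0 := fun c => by
    rw [← hq0]; exact hq _ _ _ _ fun _ _ _ => rfl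
  refine ⟨⟨_, hloc⟩, hT, fun u _ h => hloc.support_finite (by simp [hz]) h, fun u _ h => ?_⟩
  have hf := hq.support_finite hq0 h
  have hf1 : (Function.support fun j => q u (j - 1)).Finite := support_shift_finite (-1) hf
  have hf2 := support_shift_finite 1 hf
  have hmul : ∀ (c : ℤ) {w : ℤ → ℤ}, w.support.Finite →
      (Function.support fun j => c * w j).Finite := fun c w hw =>
    hw.subset fun j hj => right_ne_zero_of_mul hj
  have hf3 : (Function.support fun j => -a * q u j + -1 * q u (j + 1)).Finite :=
    ((hmul (-a) hf).union (hmul (-1) hf2)).subset (Function.support_add _ _)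
  have hf4 : (Function.support fun j =>
      q u (j - 1) + (-a * q u j + -1 * q u (j + 1))).Finite :=
    (hf1.union hf3).subset (Function.support_add _ _)
  rw [intValue_add β h hf4, intValue_add β hf1 hf3,
    intValue_add β (hmul (-a) hf) (hmul (-1) hf2), intValue_const_mul,
    intValue_const_mul, intValue_shift hβ0]
  have : intValue β (fun j => q u (j - 1)) = β ^ (-(-1 : ℤ)) * intValue β (q u) :=
    intValue_shift hβ0 (-1) (q u)
  rw [this, neg_neg, zpow_one, zpow_neg_one]
  have hb : β⁻¹ = β - a := by
    field_simp
    linarith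
  rw [hb]
  push_cast
  ring

/-- In base the golden mean, one carry step separates the maximal digits. -/
lemma exists_converts_separated {β : ℝ} (hβ : 1 < β) (hroot : β ^ 2 = ((1 : ℤ) : ℝ) * β + 1)
    {m : ℤ} (hm : m ≤ 0) (hm' : -1 ≤ m) :
    ∃ φ, Converts β (digits m (m + 3))
      {u | u ∈ digits m (m + 3) ∧ ∀ j, ¬ (u (j - 1) = m + 3 ∧ u j = m + 3)} φ := by
  let q : (ℤ → ℤ) → ℤ → ℤ := fun u j => if m + 2 ≤ u j ∧ m + 2 ≤ u (j - 1) then 1 else 0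
  have hq : LocalAt 1 q := by
    intro u v j k huv
    have h0 := huv 0 (by omega) (by omega)
    have h1 := huv (-1) (by omega) (by omega)
    simp only [add_zero] at h0
    simp only [q, sub_eq_add_neg, h0, h1]
  refine ⟨_, converts_of_carry hβ hroot hq (by simp [q]; omega)
    fun u hu => ⟨fun j => ?_, fun j => ?_⟩⟩
  · have h0 := hu j
    have h1 := hu (j - 1)
    simp only [q, add_sub_cancel_right]
    split_ifs <;> omega
  · have h0 := hu j
    have h1 := hu (j - 1)
    simp only [q, add_sub_cancel_right, sub_add_cancel]
    split_ifs <;> omega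

/-- Greatest digit elimination. -/
lemma exists_converts_succ {a : ℤ} (ha : 1 ≤ a) {β : ℝ} (hβ : 1 < β)
    (hroot : β ^ 2 = (a : ℝ) * β + 1) {m M : ℤ} (hm : m ≤ 0) (hM : 1 ≤ M) (hmM : M - m = a + 1) :
    ∃ φ, Converts β (digits m (M + 1)) (digits m M) φ := by
  have key : ∀ S ⊆ digits m (M + 1),
      (a = 1 → ∀ u ∈ S, ∀ j, ¬ (u (j - 1) = m + 3 ∧ u j = m + 3)) →
      ∃ φ, Converts β S (digits m M) φ := by
    intro S hS hsep
    let q : (ℤ → ℤ) → ℤ → ℤ := fun u j => carry a (u (j - 2) - m) (u (j - 1) - m) (u j - m)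
      (u (j + 1) - m) (u (j + 2) - m) (u (j + 3) - m)
    have hq : LocalAt 3 q := by
      intro u v j k huv
      have h0 := huv 0 (by omega) (by omega)
      have h1 := huv (-1) (by omega) (by omega)
      have h2 := huv (-2) (by omega) (by omega)
      have h3 := huv 1 (by omega) (by omega)
      have h4 := huv 2 (by omega) (by omega)
      have h5 := huv 3 (by omega) (by omega)
      simp only [add_zero] at h0
      simp only [q, sub_eq_add_neg, h0, h1, h2, h3, h4, h5]
    have hq0 : q 0 0 = 0 := by
      have h : ¬ CarriesUp a (-m) (-m) (-m) (-m) := by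
        unfold CarriesUp
        omega
      simp [q, carry, h]
    refine ⟨_, converts_of_carry hβ hroot hq hq0 fun u hu j => ?_⟩
    have hb := fun i => hS hu (j + i)
    have h0 := hb 0
    have h1 := hb (-1)
    have h2 := hb 1
    rw [add_zero] at h0
    have hc := carry_bounds ha (u (j - 3) - m) (u (j - 2) - m) (u (j - 1) - m) (u j - m)
      (u (j + 1) - m) (u (j + 2) - m) (u (j + 3) - m) (u (j + 4) - m) (by omega) (by omega)
      (by rw [sub_eq_add_neg j]; omega) (by omega) (fun h => by
        have := hsep h u hu j
        omega)
    have e1 : q u (j - 1) = carry a (u (j - 3) - m) (u (j - 2) - m) (u (j - 1) - m) (u j - m)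
      (u (j + 1) - m) (u (j + 2) - m) := by
      simp only [q]; ring_nf
    have e2 : q u (j + 1) = carry a (u (j - 1) - m) (u j - m)
      (u (j + 1) - m) (u (j + 2) - m) (u (j + 3) - m) (u (j + 4) - m) := by
      simp only [q]; ring_nf
    dsimp only
    rw [e1, e2]
    simp only [q]
    constructor <;> linarith [hc.1, hc.2]
  by_cases h1 : a = 1
  · subst h1
    obtain rfl : M = m + 2 := by omega
    obtain ⟨φ, hφ⟩ := exists_converts_separated hβ hroot hm (by omega)
    obtain ⟨ψ, hψ⟩ := key {u | u ∈ digits m (m + 3) ∧ ∀ j, ¬ (u (j - 1) = m + 3 ∧ u j = m + 3)}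
      (fun u hu => by
        have := hu.1
        rwa [show m + 2 + 1 = m + 3 by ring]) (fun _ u hu => hu.2)
    rw [show m + 2 + 1 = m + 3 by ring]
    exact ⟨_, hφ.comp hψ⟩
  · exact key _ subset_rfl fun h => absurd h h1

lemma Converts.mono {β : ℝ} {S S' T : Set (ℤ → ℤ)} {φ : (ℤ → ℤ) → ℤ → ℤ}
    (hφ : Converts β S T φ) (h : S' ⊆ S) : Converts β S' T φ :=
  ⟨hφ.isLocal, fun u hu => hφ.mapsTo u (h hu), fun u hu => hφ.finite u (h hu),
    fun u hu => hφ.value u (h hu)⟩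

lemma exists_converts_add {a : ℤ} (ha : 1 ≤ a) {β : ℝ} (hβ : 1 < β)
    (hroot : β ^ 2 = (a : ℝ) * β + 1) {m M : ℤ} (hm : m ≤ 0) (hM : 1 ≤ M) (hmM : M - m = a + 1)
    (k : ℕ) : ∃ φ, Converts β (digits m (M + (k + 1 : ℕ))) (digits m M) φ := by
  obtain ⟨ψ, hψ⟩ := exists_converts_succ ha hβ hroot hm hM hmM
  induction k with
  | zero => exact ⟨ψ, by simpa using hψ⟩
  | succ k ih =>
    obtain ⟨φ, hφ⟩ := ih
    refine ⟨_, (hφ.split (S := digits m (M + (k + 1 + 1 : ℕ))) (R := digits m (M + 1))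
      (fun x => min x (M + (k + 1 : ℕ))) (by push_cast; omega) (fun u hu j => ?_)
      (fun u hu t ht j => ?_)).comp hψ⟩
    · have := hu j
      push_cast at *
      omega
    · have := hu j
      have := ht j
      push_cast at *
      omega

lemma exists_converts_double {a : ℤ} (ha : 1 ≤ a) {β : ℝ} (hβ : 1 < β)
    (hroot : β ^ 2 = (a : ℝ) * β + 1) {m M : ℤ} (hm : m ≤ 0) (hM : 0 ≤ M) (hmM : M - m = a + 1) :
    ∃ φ, Converts β (digits (2 * m) (2 * M)) (digits m M) φ := by
  have up : 1 ≤ M → ∃ φ, Converts β (digits m (2 * M)) (digits m M) φ := fun hM => by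
    obtain ⟨φ, hφ⟩ := exists_converts_add ha hβ hroot hm hM hmM M.toNat
    refine ⟨φ, hφ.mono fun u hu j => ?_⟩
    have := hu j
    push_cast
    omega
  have down : m ≤ -1 → ∃ φ, Converts β (digits (2 * m) M) (digits m M) φ := fun hm => by
    obtain ⟨φ, hφ⟩ := exists_converts_add ha hβ hroot (m := -M) (M := -m) (by omega) (by omega)
      (by omega) (-m).toNat
    have hφ' := hφ.neg
    rw [neg_neg, neg_neg] at hφ'
    refine ⟨_, hφ'.mono fun u hu j => ?_⟩
    have := hu j
    push_cast
    omega
  rcases eq_or_lt_of_le hm with rfl | hm'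
  · exact up (by omega)
  rcases eq_or_lt_of_le hM with rfl | hM'
  · exact down (by omega)
  obtain ⟨φ, hφ⟩ := up (by omega)
  obtain ⟨ψ, hψ⟩ := down (by omega)
  refine ⟨_, (hφ.split (S := digits (2 * m) (2 * M)) (R := digits (2 * m) M)
      (fun x => max x m) (by omega) (fun u hu j => ?_) (fun u hu t ht j => ?_)).comp hψ⟩
  · have := hu j
    dsimp only
    omega
  · have := hu j
    have := ht j
    dsimp only
    omega

lemma intAlphabet_add_self {m M : ℤ} (hmM : m ≤ M) :
    intAlphabet m M + intAlphabet m M = intAlphabet (2 * m) (2 * M) := by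
  ext x
  constructor
  · rintro ⟨_, ⟨k, hk, rfl⟩, _, ⟨l, hl, rfl⟩, rfl⟩
    exact ⟨k + l, ⟨by linarith [hk.1, hl.1], by linarith [hk.2, hl.2]⟩, by push_cast; rfl⟩
  · rintro ⟨k, hk, rfl⟩
    obtain ⟨h1, h2⟩ := hk
    exact ⟨_, ⟨max m (k - M), ⟨by omega, by omega⟩, rfl⟩, _,
      ⟨k - max m (k - M), ⟨by omega, by omega⟩, rfl⟩, by push_cast; ring⟩

/-- Parallel conversion between integer alphabets can be expressed with integer strings. -/
lemma parallelConversion_intAlphabet_iff {β : ℝ} {m M m' M' : ℤ} :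
    ParallelConversion β (intAlphabet m M) (intAlphabet m' M') ↔
      ∃ φ, Converts β (digits m M) (digits m' M') φ := by
  constructor
  · rintro ⟨p, φ, Φ, ⟨r, t, rfl, hloc⟩, hmaps, hval⟩
    have hmem : ∀ u ∈ digits m M, ∀ j, ((u j : ℤ) : ℝ) ∈ intAlphabet m M :=
      fun u hu j => ⟨u j, hu j, rfl⟩
    have hcast : ∀ u ∈ digits m M, ∀ j,
        ((⌊φ (fun i => (u i : ℝ)) j⌋ : ℤ) : ℝ) = φ (fun i => (u i : ℝ)) j := fun u hu j => by
      obtain ⟨k, -, hk⟩ := hmaps _ (hmem u hu) j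
      rw [← hk]
      simp
    have hsupp : ∀ u : ℤ → ℤ, u.support.Finite →
        (Function.support fun i => (u i : ℝ)).Finite := fun u hu => by
      simpa [Function.support] using hu
    refine ⟨fun u j => ⌊φ (fun i => (u i : ℝ)) j⌋, ⟨⟨max r t, fun u v j k huv => ?_⟩,
      fun u hu j => ?_, fun u hu h => ?_, fun u hu h => ?_⟩⟩
    · dsimp only
      rw [hloc, hloc]
      congr 2
      ext i
      have := i.2
      have h := huv (t - (i : ℕ)) (by omega) (by omega)
      rw [← add_sub_assoc, ← add_sub_assoc] at h
      rw [h]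
    · obtain ⟨k, hk, hk'⟩ := hmaps _ (hmem u hu) j
      rw [← hk']
      simpa using hk
    · refine (hval _ (hmem u hu) (hsupp u h)).1.subset fun j hj => ?_
      contrapose! hj
      simp_all
    · unfold intValue
      rw [← (hval _ (hmem u hu) (hsupp u h)).2]
      congr 1
      ext j
      exact hcast u hu j
  · rintro ⟨φ, ⟨N, hN⟩, hmaps, hfin, hval⟩
    have hfloor : ∀ u : ℤ → ℝ, (∀ j, u j ∈ intAlphabet m M) →
        ∃ w ∈ digits m M, u = fun j => (w j : ℝ) := fun u hu => by
      choose w hw hw' using hu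
      exact ⟨w, hw, funext fun j => (hw' j).symm⟩
    refine ⟨N + N + 1, fun u j => (φ (fun i => ⌊u i⌋) j : ℝ), fun w =>
      (φ (fun i => if h : (N - i).toNat < N + N + 1 then ⌊w ⟨(N - i).toNat, h⟩⌋ else 0) 0 : ℝ),
      ⟨N, N, rfl, fun u j => ?_⟩, fun u hu j => ?_, fun u hu h => ?_⟩
    · dsimp only
      congr 1
      refine hN _ _ _ _ fun i h1 h2 => ?_
      have h3 : (N - (0 + i)).toNat < N + N + 1 := by omega
      rw [dif_pos h3]
      congr 2
      omega
    · obtain ⟨w, hw, rfl⟩ := hfloor u hu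
      simp only [Int.floor_intCast]
      exact ⟨_, hmaps w hw j, rfl⟩
    · obtain ⟨w, hw, rfl⟩ := hfloor u hu
      have h' : w.support.Finite := by simpa [Function.support] using h
      simp only [Int.floor_intCast]
      exact ⟨by simpa [Function.support] using hfin w hw h', hval w hw h'⟩

lemma pow_mul_intValue {β : ℝ} (hβ : β ≠ 0) {u : ℤ → ℤ} (K n : ℕ)
    (hu : ∀ j : ℤ, j < -K ∨ (n : ℤ) - K ≤ j → u j = 0) :
    β ^ K * intValue β u = ∑ i ∈ Finset.range n, (u (i - K) : ℝ) * β ^ i := by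
  have hinj : Function.Injective fun i : ℕ => (i : ℤ) - K := fun x y h => by
    dsimp only at h
    omega
  unfold intValue seqValue
  rw [finsum_eq_sum_of_support_subset (s := (Finset.range n).map ⟨_, hinj⟩), Finset.sum_map,
    Finset.mul_sum]
  · refine Finset.sum_congr rfl fun i _ => ?_
    dsimp only [Function.Embedding.coeFn_mk]
    rw [mul_left_comm, ← zpow_natCast, ← zpow_add₀ hβ, add_sub_cancel, zpow_natCast]
  · intro j hj
    have hj' : u j ≠ 0 := fun h => hj (by simp [h])
    have : ¬ (j < -K ∨ (n : ℤ) - K ≤ j) := fun h => hj' (hu j h)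
    simp only [Finset.coe_map, Function.Embedding.coeFn_mk, Set.mem_image, Finset.coe_range,
      Set.mem_Iio]
    exact ⟨(j + K).toNat, by omega, by omega⟩

lemma eq_zero_of_mul_add_eq_zero {a : ℤ} (ha : 1 ≤ a) {β : ℝ}
    (hroot : β ^ 2 = (a : ℝ) * β + 1) {r s : ℤ} (h : (r : ℝ) * β + s = 0) : r = 0 ∧ s = 0 := by
  have hr : r = 0 := by
    by_contra hr
    have h1 : ((2 * s + a * r : ℤ) : ℝ) ^ 2 = ((r ^ 2 * (a ^ 2 + 4) : ℤ) : ℝ) := by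
      have hs : (s : ℝ) = -(r * β) := by linarith
      push_cast
      rw [hs]
      linear_combination 4 * (r : ℝ) ^ 2 * hroot
    have h2 : (2 * s + a * r) ^ 2 = r ^ 2 * (a ^ 2 + 4) := by exact_mod_cast h1
    obtain ⟨k, hk⟩ := (Int.pow_dvd_pow_iff two_ne_zero).1 (Dvd.intro _ h2.symm)
    rw [hk, mul_pow] at h2
    have h3 : |k| ^ 2 = a ^ 2 + 4 := by
      rw [sq_abs]
      exact mul_left_cancel₀ (pow_ne_zero 2 hr) h2
    have h4 : a < |k| := by
      by_contra! hcon
      nlinarith [abs_nonneg k]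
    obtain h5 | h5 : |k| = a + 1 ∨ a + 2 ≤ |k| := by omega
    · rw [h5] at h3
      have : 2 * a = 3 := by linarith
      omega
    · nlinarith
  subst hr
  exact ⟨rfl, by simpa using h⟩

lemma exists_pow_eq {a : ℤ} {β : ℝ} (hroot : β ^ 2 = (a : ℝ) * β + 1) (n : ℕ) :
    ∃ r s : ℤ, β ^ n = r * β + s ∧ a ∣ 1 - (r + s) := by
  induction n with
  | zero => exact ⟨0, 1, by simp, by simp⟩
  | succ n ih =>
    obtain ⟨r, s, h, k, hk⟩ := ih
    refine ⟨r * a + s, r, ?_, k - r, by linarith⟩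
    rw [pow_succ, h]
    push_cast
    linear_combination (r : ℝ) * hroot

/-- A representation of zero has digit sum divisible by `a`, as `X² - aX - 1` takes the value `-a`
at `1`. -/
lemma dvd_sum_of_sum_mul_pow_eq_zero {a : ℤ} (ha : 1 ≤ a) {β : ℝ}
    (hroot : β ^ 2 = (a : ℝ) * β + 1) {n : ℕ} {f : ℕ → ℤ}
    (hf : ∑ i ∈ Finset.range n, (f i : ℝ) * β ^ i = 0) : a ∣ ∑ i ∈ Finset.range n, f i := by
  choose r s h hd using exists_pow_eq hroot
  have h0 : ((∑ i ∈ Finset.range n, f i * r i : ℤ) : ℝ) * β +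
      (∑ i ∈ Finset.range n, f i * s i : ℤ) = 0 := by
    rw [← hf]
    push_cast
    rw [Finset.sum_mul, ← Finset.sum_add_distrib]
    refine Finset.sum_congr rfl fun i _ => ?_
    rw [h i]
    ring
  obtain ⟨h1, h2⟩ := eq_zero_of_mul_add_eq_zero ha hroot h0
  have : ∑ i ∈ Finset.range n, f i = ∑ i ∈ Finset.range n, f i * (1 - (r i + s i)) := by
    simp only [mul_sub, mul_add, mul_one, Finset.sum_sub_distrib, Finset.sum_add_distrib, h1, h2]
    simp
  rw [this]
  exact Finset.dvd_sum fun i _ => (hd i).mul_left _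

lemma finite_support_of_window {u : ℤ → ℤ} {k n : ℤ} (hu : ∀ j, j < k ∨ n ≤ j → u j = 0) :
    u.support.Finite := by
  refine (Set.finite_Ico k n).subset fun j hj => ?_
  have : ¬ (j < k ∨ n ≤ j) := fun h => hj (hu j h)
  simp only [Set.mem_Ico]
  omega

lemma Converts.map_zero {β : ℝ} {S T : Set (ℤ → ℤ)} {φ : (ℤ → ℤ) → ℤ → ℤ}
    (hφ : Converts β S T φ) (h0 : 0 ∈ S) (j : ℤ) : φ 0 j = 0 := by
  obtain ⟨N, hN⟩ := hφ.isLocal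
  have hc : ∀ k, φ 0 k = φ 0 j := fun k => hN _ _ _ _ fun _ _ _ => rfl
  by_contra hne
  refine Set.infinite_univ (α := ℤ) ((hφ.finite 0 h0 (by simp)).subset fun k _ => ?_)
  rw [Function.mem_support, hc]
  exact hne

/-- The block of `n` digits `b` starting at position `0`. -/
def block (b : ℤ) (n : ℕ) (j : ℤ) : ℤ := if 0 ≤ j ∧ j < n then b else 0

/-- Constant strings are mapped to constant strings congruent to them modulo `a`. -/
lemma Converts.dvd_sub_const {a : ℤ} (ha : 1 ≤ a) {β : ℝ} (hβ : 1 < β)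
    (hroot : β ^ 2 = (a : ℝ) * β + 1) {m M : ℤ} {T : Set (ℤ → ℤ)} {φ : (ℤ → ℤ) → ℤ → ℤ}
    (hφ : Converts β (digits m M) T φ) (hm : m ≤ 0) (hM : 0 ≤ M) {b : ℤ} (hb : b ∈ Set.Icc m M) :
    a ∣ b - φ (fun _ => b) 0 := by
  obtain ⟨N, hN⟩ := hφ.isLocal
  have hβ0 : β ≠ 0 := by positivity
  have hS : ∀ n, block b n ∈ digits m M := fun n j => by
    unfold block
    split_ifs
    exacts [hb, ⟨hm, hM⟩]
  have hzero : ∀ (n : ℕ) (j : ℤ), j < 0 ∨ n ≤ j → block b n j = 0 := fun n j hj => by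
    unfold block
    rw [if_neg (by omega)]
  have hzero' : ∀ (n : ℕ) (j : ℤ), j < -N ∨ n + N ≤ j → φ (block b n) j = 0 := fun n j hj => by
    rw [← hφ.map_zero (fun j => ⟨hm, hM⟩) 0]
    refine hN _ _ _ _ fun i h1 h2 => ?_
    rw [hzero n _ (by omega)]
    rfl
  set n := 2 * N + 1 with hn
  set v := φ (block b n) with hv
  set v' := φ (block b (n + 1)) with hv'
  have hlow : ∀ j ≤ (N : ℤ), v' j = v j := fun j hj => hN _ _ _ _ fun i h1 h2 => by
    unfold block
    split_ifs <;> omega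
  have hhigh : ∀ j, (N : ℤ) ≤ j → v' (j + 1) = v j := fun j hj => hN _ _ _ _ fun i h1 h2 => by
    unfold block
    split_ifs <;> omega
  have hmid : v N = φ (fun _ => b) 0 := hN _ _ _ _ fun i h1 h2 => by
    unfold block
    rw [if_pos (by omega)]
  have hdvd : ∀ k, k ≤ n + 1 → a ∣ ∑ i ∈ Finset.range (n + 1 + 2 * N),
      (φ (block b k) (i - N) - block b k (i - N)) := fun k hk => by
    refine dvd_sum_of_sum_mul_pow_eq_zero ha hroot ?_
    have := congrArg (β ^ N * ·) (hφ.value _ (hS k) (finite_support_of_window (hzero k)))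
    rw [pow_mul_intValue hβ0 N (n + 1 + 2 * N) (fun j hj => hzero' k j (by omega)),
      pow_mul_intValue hβ0 N (n + 1 + 2 * N) (fun j hj => hzero k j (by omega))] at this
    simp only [Int.cast_sub, sub_mul, Finset.sum_sub_distrib]
    linarith
  have h1 : ∑ i ∈ Finset.range (n + 1 + 2 * N), (v' (i - N) - v (i - N)) = φ (fun _ => b) 0 := by
    rw [show n + 1 + 2 * N = n + (2 * N + 1) by ring, Finset.sum_range_add,
      Finset.sum_eq_zero, zero_add]
    · have : ∀ i : ℕ, v' ((n + i : ℕ) - N) - v ((n + i : ℕ) - N) =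
          v (N + i) - v (N + (i + 1 : ℕ)) := fun i => by
        rw [← hhigh (N + i) (by omega)]
        congr 2 <;> push_cast [hn] <;> ring
      simp only [this]
      rw [Finset.sum_range_sub' (fun i : ℕ => v (N + i))]
      rw [hv, hzero' n (N + (2 * N + 1 : ℕ)) (by omega), ← hv]
      simp [hmid]
    · intro i hi
      rw [Finset.mem_range] at hi
      rw [hlow _ (by omega), sub_self]
  have h2 : ∑ i ∈ Finset.range (n + 1 + 2 * N),
      (block b (n + 1) (i - N) - block b n (i - N)) = b := by
    rw [Finset.sum_eq_single (n + N)]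
    · unfold block
      rw [if_pos (by omega), if_neg (by omega), sub_zero]
    · intro i _ hi
      unfold block
      split_ifs <;> omega
    · intro h
      rw [Finset.mem_range] at h
      omega
  have h3 := dvd_sub (hdvd n (by omega)) (hdvd (n + 1) le_rfl)
  simp only [← hv, ← hv', Finset.sum_sub_distrib] at h1 h2 h3
  obtain ⟨k, hk⟩ := h3
  exact ⟨k, by linarith⟩

/-- A constant string of a non-maximal digit is not mapped to the maximal digit: the image could
not be increased by increasing the digits at low positions. -/
lemma Converts.const_ne_max {β : ℝ} (hβ : 1 < β) {m M m' M' : ℤ} {φ : (ℤ → ℤ) → ℤ → ℤ}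
    (hφ : Converts β (digits m M) (digits m' M') φ) (hm : m ≤ 0) (hM : 0 ≤ M)
    {b : ℤ} (hb : m ≤ b) (hb' : b < M) : φ (fun _ => b) 0 ≠ M' := by
  intro hmax
  obtain ⟨N, hN⟩ := hφ.isLocal
  have hβ0 : β ≠ 0 := by positivity
  obtain ⟨k, hk⟩ := exists_nat_gt (∑ i ∈ Finset.range (2 * N), ((M' - m' : ℤ) : ℝ) * β ^ i)
  set n := k + 2 * N + 1 with hn
  let w : ℤ → ℤ := fun j => if 0 ≤ j ∧ j < k then M else block b n j
  have hS : block b n ∈ digits m M := fun j => by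
    unfold block
    split_ifs <;> omega
  have hSw : w ∈ digits m M := fun j => by
    simp only [w, block]
    split_ifs <;> omega
  have hzero : ∀ j : ℤ, j < 0 ∨ n ≤ j → block b n j = 0 := fun j hj => by
    unfold block
    rw [if_neg (by omega)]
  have hzerow : ∀ j : ℤ, j < 0 ∨ n ≤ j → w j = 0 := fun j hj => by
    simp only [w]
    rw [if_neg (by omega), hzero j hj]
  have hzero' : ∀ u : ℤ → ℤ, (∀ j : ℤ, j < 0 ∨ n ≤ j → u j = 0) →
      ∀ j : ℤ, j < -N ∨ n + N ≤ j → φ u j = 0 := fun u hu j hj => by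
    rw [← hφ.map_zero (fun j => ⟨hm, hM⟩) 0]
    refine hN _ _ _ _ fun i h1 h2 => ?_
    rw [hu _ (by omega)]
    rfl
  have hval : ∀ u ∈ digits m M, (∀ j : ℤ, j < 0 ∨ n ≤ j → u j = 0) →
      ∑ i ∈ Finset.range (2 * N + n), (φ u (i - N) : ℝ) * β ^ i =
        ∑ i ∈ Finset.range (2 * N + n), (u (i - N) : ℝ) * β ^ i := fun u hu hz => by
    rw [← pow_mul_intValue hβ0 N _ (fun j hj => hz j (by omega)),
      ← pow_mul_intValue hβ0 N _ (fun j hj => hzero' u hz j (by omega)),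
      hφ.value u hu (finite_support_of_window hz)]
  have hle : ∑ i ∈ Finset.range (2 * N + n),
      ((φ w (i - N) : ℝ) - (φ (block b n) (i - N) : ℝ)) * β ^ i ≤
        ∑ i ∈ Finset.range (2 * N), ((M' - m' : ℤ) : ℝ) * β ^ i := by
    rw [Finset.sum_range_add]
    refine add_le_of_le_of_nonpos (Finset.sum_le_sum fun i _ => ?_)
      (Finset.sum_nonpos fun i _ => ?_)
    · have h1 := hφ.mapsTo _ hSw (i - N)
      have h2 := hφ.mapsTo _ hS (i - N)
      gcongr
      rw [← Int.cast_sub]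
      exact Int.cast_le.2 (by omega)
    · refine mul_nonpos_of_nonpos_of_nonneg ?_ (by positivity)
      rw [sub_nonpos, Int.cast_le]
      rcases lt_or_ge i (k + 1) with hi | hi
      · have : φ (block b n) ((2 * N + i : ℕ) - N) = M' := by
          rw [← hmax]
          refine hN _ _ _ _ fun l h1 h2 => ?_
          unfold block
          rw [if_pos (by omega)]
        rw [this]
        exact (hφ.mapsTo _ hSw _).2
      · refine le_of_eq (hN _ _ _ _ fun l h1 h2 => ?_)
        simp only [w]
        rw [if_neg (by omega)]
  have hge : (k : ℝ) ≤ ∑ i ∈ Finset.range (2 * N + n),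
      ((w (i - N) : ℝ) - (block b n (i - N) : ℝ)) * β ^ i := by
    have hterm : ∀ i : ℕ, (0 : ℝ) ≤ ((w (i - N) : ℝ) - (block b n (i - N) : ℝ)) * β ^ i :=
      fun i => by
        refine mul_nonneg ?_ (by positivity)
        rw [sub_nonneg, Int.cast_le]
        simp only [w, block]
        split_ifs <;> omega
    calc (k : ℝ) = ∑ i ∈ Finset.Ico N (N + k), (1 : ℝ) := by simp
      _ ≤ ∑ i ∈ Finset.Ico N (N + k),
          ((w (i - N) : ℝ) - (block b n (i - N) : ℝ)) * β ^ i := by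
        refine Finset.sum_le_sum fun i hi => ?_
        rw [Finset.mem_Ico] at hi
        refine one_le_mul_of_one_le_of_one_le ?_ (one_le_pow₀ hβ.le)
        rw [← Int.cast_sub]
        refine Int.cast_one_le_of_pos ?_
        simp only [w, block]
        rw [if_pos (by omega), if_pos (by omega)]
        omega
      _ ≤ _ := Finset.sum_le_sum_of_subset_of_nonneg (fun i hi => by
          rw [Finset.mem_Ico] at hi
          rw [Finset.mem_range]
          omega) fun i _ _ => hterm i
  simp only [sub_mul, Finset.sum_sub_distrib] at hle hge
  rw [hval _ hS hzero, hval _ hSw hzerow] at hle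
  linarith

lemma Converts.const_ne_min {β : ℝ} (hβ : 1 < β) {m M m' M' : ℤ} {φ : (ℤ → ℤ) → ℤ → ℤ}
    (hφ : Converts β (digits m M) (digits m' M') φ) (hm : m ≤ 0) (hM : 0 ≤ M)
    {b : ℤ} (hb : m < b) (hb' : b ≤ M) : φ (fun _ => b) 0 ≠ m' := by
  have := hφ.neg.const_ne_max hβ (by omega) (by omega) (b := -b) (by omega) (by omega)
  intro h
  apply this
  rw [← h]
  simp only [Pi.neg_apply, neg_inj]
  congr 1
  ext j
  simp

lemma not_converts_double {a : ℤ} (ha : 1 ≤ a) {β : ℝ} (hβ : 1 < β)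
    (hroot : β ^ 2 = (a : ℝ) * β + 1) {m M : ℤ} (hm : m ≤ 0) (hM : 1 ≤ M) (hmM : M - m ≤ a)
    {φ : (ℤ → ℤ) → ℤ → ℤ} : ¬ Converts β (digits (2 * m) (2 * M)) (digits m M) φ := by
  intro hφ
  obtain ⟨b, hb, b', hb', hne, heq⟩ := Finset.exists_ne_map_eq_of_card_lt_of_maps_to
    (s := Finset.Icc (2 * m + 1) (m + M)) (t := Finset.Icc (m + 1) (M - 1))
    (f := fun b => φ (fun _ => b) 0) (by simp only [Int.card_Icc]; omega) (fun b hb => by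
      rw [Finset.coe_Icc, Set.mem_Icc] at hb
      have h1 := hφ.const_ne_max hβ (by omega) (by omega) (b := b) (by omega) (by omega)
      have h2 := hφ.const_ne_min hβ (by omega) (by omega) (b := b) (by omega) (by omega)
      have h3 := hφ.mapsTo (fun _ => b) (fun _ => ⟨by dsimp only; omega, by dsimp only; omega⟩) 0
      rw [Finset.coe_Icc, Set.mem_Icc]
      dsimp only
      omega)
  rw [Finset.mem_Icc] at hb hb'
  have h1 := hφ.dvd_sub_const ha hβ hroot (by omega) (by omega) (b := b) ⟨by omega, by omega⟩
  have h2 := hφ.dvd_sub_const ha hβ hroot (by omega) (by omega) (b := b') ⟨by omega, by omega⟩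
  have h3 := dvd_sub h1 h2
  rw [heq, sub_sub_sub_cancel_right] at h3
  have h4 : |b - b'| < a := abs_lt.2 ⟨by omega, by omega⟩
  exact h4.not_ge (Int.le_of_dvd (abs_pos.2 (sub_ne_zero.2 hne)) ((dvd_abs _ _).2 h3))

/-- Theorem (quadratic Pisot unit, case `β² = aβ + 1`): for `a ≥ 1` and `β > 1` the
positive root of `X² - aX - 1`, every alphabet of contiguous integers containing `0` of
cardinality `a + 2` allows parallel addition in base `β`, and no alphabet of contiguous
integers containing `0` and `1` of cardinality less than `a + 2` does. -/
theorem quadratic_pisot_unit_plus_minimal_alphabet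
    (a : ℤ) (ha : 1 ≤ a) (β : ℝ) (hβ : 1 < β)
    (hroot : β ^ 2 = (a : ℝ) * β + 1) :
    (∀ m M : ℤ, m ≤ 0 → 0 ≤ M → M - m + 1 = a + 2 →
      ParallelAddition β (intAlphabet m M)) ∧
    (∀ m M : ℤ, m ≤ 0 → 1 ≤ M → M - m + 1 < a + 2 →
      ¬ ParallelAddition β (intAlphabet m M)) := by
  refine ⟨fun m M hm hM hmM => ?_, fun m M hm hM hmM => ?_⟩
  · rw [ParallelAddition, intAlphabet_add_self (by omega), parallelConversion_intAlphabet_iff]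
    exact exists_converts_double ha hβ hroot hm hM (by omega)
  · rw [ParallelAddition, intAlphabet_add_self (by omega), parallelConversion_intAlphabet_iff]
    rintro ⟨φ, hφ⟩
    exact not_converts_double ha hβ hroot hm hM (by omega) hφ
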